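/- arXiv:2112.03965 — 3 statements merged into one kernel-verified Lean document; each statement's English description precedes it below -/
import Mathlib

section
/- Let n ≥ 2 be even, let u, v ∈ S with u ≠ v, and set ŷ = (u + v)/2. Then there exists x̂ ∈ ℝ^n such that the pair (x̂, ŷ) is LP-feasible for the lot-sizing instance and Obj(x̂, ŷ) < n(n+1)/2 + n. -/
open Finset

/-- LP-feasibility for the lot-sizing instance on `n` periods with
`p_j = n - j + 1`, `f_j = 1`, `d_j = 1`.  Index `j : Fin n` represents
period `(j : ℕ) + 1 ∈ {1, …, n}`. -/
def LPFeasible (n : ℕ) (x y : Fin n → ℝ) : Prop :=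
  (∀ i : Fin n, (i : ℕ) + 1 ≤ n - 1 →
      (((i : ℕ) + 1 : ℝ)) ≤ ∑ k ∈ Finset.Iic i, x k) ∧
  (∑ k, x k = (n : ℝ)) ∧
  (∀ j : Fin n, 0 ≤ x j ∧ x j ≤ ((n : ℝ) - ((j : ℕ) + 1) + 1) * y j) ∧
  (∀ j : Fin n, 0 ≤ y j ∧ y j ≤ 1)

/-- Objective `∑ p_j x_j + ∑ f_j y_j` with `p_j = n - j + 1`, `f_j = 1`. -/
def Obj (n : ℕ) (x y : Fin n → ℝ) : ℝ :=
  (∑ j : Fin n, ((n : ℝ) - ((j : ℕ) + 1) + 1) * x j) + ∑ j : Fin n, y j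

/-- Integer feasibility: LP-feasible with binary `y`. -/
def IntFeasible (n : ℕ) (x y : Fin n → ℝ) : Prop :=
  LPFeasible n x y ∧ ∀ j, y j = 0 ∨ y j = 1

/-- For even `n`: the set of 0/1 vectors with `y_1 = 1` and coordinates at even periods equal 1. -/
def Seven (n : ℕ) : Set (Fin n → ℝ) :=
  {y | (∀ j, y j = 0 ∨ y j = 1) ∧ (∀ j : Fin n, (j : ℕ) + 1 = 1 → y j = 1) ∧
    ∀ j : Fin n, Even ((j : ℕ) + 1) → y j = 1}

/-- Abel summation for the production cost of the plan `1 - z k + z (k + 1)`. -/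
lemma sum_price_mul_shift (c : ℝ) (z : ℕ → ℝ) (m : ℕ) :
    ∑ k ∈ range m, (c - ((k : ℕ) + 1) + 1) * (1 - z k + z (k + 1)) =
      m * c - m * (m - 1) / 2 + (c - m + 1) * z m - (c + 1) * z 0 + ∑ k ∈ range m, z k := by
  induction m with
  | zero => simp
  | succ m ih => rw [sum_range_succ, ih, sum_range_succ]; push_cast; ring

lemma sum_range_shift (z : ℕ → ℝ) (m : ℕ) :
    ∑ k ∈ range m, (1 - z k + z (k + 1)) = m + z m - z 0 := by
  induction m with
  | zero => simp
  | succ m ih => rw [sum_range_succ, ih]; push_cast; ring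

lemma sum_Iic_fin_eq_sum_range {n : ℕ} (f : ℕ → ℝ) (i : Fin n) :
    ∑ k ∈ Iic i, f k = ∑ k ∈ range ((i : ℕ) + 1), f k := by
  rw [Nat.range_succ_eq_Iic, ← Fin.map_valEmbedding_Iic, sum_map]
  rfl

/-- Unit demand of each closed period is produced one period earlier.  With `y` bounded by one and
strictly between zero and one somewhere, this plan beats the all-open one. -/
lemma exists_xhat_of_halfIntegral (n : ℕ) (heven : Even n) (y : Fin n → ℝ)
    (hy : ∀ j, y j = 0 ∨ y j = 1 / 2 ∨ y j = 1)
    (hfirst : ∀ j : Fin n, (j : ℕ) + 1 = 1 → y j = 1)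
    (hyeven : ∀ j : Fin n, Even ((j : ℕ) + 1) → y j = 1)
    (hhalf : ∃ j, y j = 1 / 2) :
    ∃ xhat : Fin n → ℝ, LPFeasible n xhat y ∧ Obj n xhat y < (n : ℝ) * (n + 1) / 2 + n := by
  classical
  set z : ℕ → ℝ := fun k => if ∃ h : k < n, y ⟨k, h⟩ = 0 then 1 else 0 with hz
  have z_nonneg (k : ℕ) : 0 ≤ z k := by simp only [hz]; split_ifs <;> norm_num
  have z_le_one (k : ℕ) : z k ≤ 1 := by simp only [hz]; split_ifs <;> norm_num
  have z_fin (j : Fin n) : z j = if y j = 0 then 1 else 0 := by simp [hz]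
  have z_odd {k : ℕ} (hk : Odd k) : z k = 0 := by
    simp only [hz]
    rw [if_neg]
    rintro ⟨h, h0⟩
    have := hyeven ⟨k, h⟩ hk.add_one
    linarith
  have z_zero : z 0 = 0 := by
    simp only [hz]
    rw [if_neg]
    rintro ⟨h, h0⟩
    have := hfirst ⟨0, h⟩ rfl
    linarith
  have z_end : z n = 0 := by simp [hz]
  refine ⟨fun j => 1 - z j + z (j + 1), ⟨?_, ?_, ?_, ?_⟩, ?_⟩
  · intro i _
    rw [sum_Iic_fin_eq_sum_range (fun k => 1 - z k + z (k + 1)), sum_range_shift, z_zero]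
    push_cast
    linarith [z_nonneg (i + 1)]
  · rw [Fin.sum_univ_eq_sum_range (fun k => 1 - z k + z (k + 1)), sum_range_shift, z_zero, z_end]
    ring
  · intro j
    refine ⟨by linarith [z_nonneg (j + 1), z_le_one j], ?_⟩
    beta_reduce
    rcases Nat.even_or_odd (j : ℕ) with hj | hj
    · have hlt : (j : ℕ) + 2 ≤ n := by
        have := j.2
        obtain ⟨a, ha⟩ := hj
        obtain ⟨b, hb⟩ := heven
        omega
      have hlt' : ((j : ℕ) : ℝ) + 2 ≤ n := by exact_mod_cast hlt
      rw [z_odd hj.add_one, z_fin]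
      rcases hy j with h | h | h <;> rw [h] <;> norm_num <;> linarith
    · rw [z_odd hj, hyeven j hj.add_one]
      rcases Nat.lt_or_ge ((j : ℕ) + 1) n with hlt | hge
      · have hlt' : ((j : ℕ) : ℝ) + 2 ≤ n := by exact_mod_cast hlt
        linarith [z_le_one (j + 1)]
      · have heq : (j : ℕ) + 1 = n := le_antisymm j.2 hge
        have hcast : ((j : ℕ) : ℝ) + 1 = n := by exact_mod_cast heq
        rw [heq, z_end]
        linarith
  · intro j
    rcases hy j with h | h | h <;> rw [h] <;> norm_num
  · have hlt : ∑ j : Fin n, (z j + y j) < ∑ _j : Fin n, (1 : ℝ) := by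
      obtain ⟨i, hi⟩ := hhalf
      refine sum_lt_sum (fun j _ => ?_) ⟨i, mem_univ i, ?_⟩
      · rw [z_fin]
        rcases hy j with h | h | h <;> rw [h] <;> norm_num
      · rw [z_fin, hi]
        norm_num
    rw [sum_add_distrib, Fin.sum_univ_eq_sum_range z] at hlt
    simp only [sum_const, card_univ, Fintype.card_fin, nsmul_eq_mul, mul_one] at hlt
    unfold Obj
    rw [Fin.sum_univ_eq_sum_range
      (fun k => ((n : ℝ) - ((k : ℕ) + 1) + 1) * (1 - z k + z (k + 1))),
      sum_price_mul_shift, z_zero, z_end]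
    linarith

/-- for even `n ≥ 2` and distinct `u, v ∈ S`, with `ŷ = (u+v)/2`,
there is `x̂` so that `(x̂, ŷ)` is LP-feasible with objective strictly below
`n(n+1)/2 + n`. -/
theorem exists_xhat_better_even (n : ℕ) (hn : 2 ≤ n) (heven : Even n)
    (u v : Fin n → ℝ) (hu : u ∈ Seven n) (hv : v ∈ Seven n) (huv : u ≠ v) :
    ∃ xhat : Fin n → ℝ,
      LPFeasible n xhat (fun j => (u j + v j) / 2) ∧
      Obj n xhat (fun j => (u j + v j) / 2) < (n : ℝ) * (n + 1) / 2 + n := by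
  obtain ⟨hu01, hu1, hueven⟩ := hu
  obtain ⟨hv01, hv1, hveven⟩ := hv
  refine exists_xhat_of_halfIntegral n heven _ (fun j => ?_) (fun j hj => ?_) (fun j hj => ?_) ?_
  · rcases hu01 j with h | h <;> rcases hv01 j with h' | h' <;> simp [h, h']
  · simp [hu1 j hj, hv1 j hj]
  · simp [hueven j hj, hveven j hj]
  · obtain ⟨i, hi⟩ := Function.ne_iff.mp huv
    refine ⟨i, ?_⟩
    rcases hu01 i with h | h <;> rcases hv01 i with h' | h' <;> simp_all
end

section
/- Let n ≥ 2 be even and let C ⊆ ℝ^n be a convex set such that every LP-feasible pair (x, y) for the lot-sizing instance with y ∈ C satisfies Obj(x, y) ≥ n(n+1)/2 + n. Then C contains at most one element of S. -/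
open Finset

/-- Summation by parts for the production plan `x k = 1 + z (k + 1) - z k`. -/
theorem sum_range_cost_shift (n : ℕ) (z : ℕ → ℝ) (h0 : z 0 = 0) (hzn : z n = 0) :
    ∑ k ∈ range n, ((n : ℝ) - (k + 1) + 1) * (1 + z (k + 1) - z k) =
      (n : ℝ) * (n + 1) / 2 + ∑ k ∈ range n, z k := by
  have partialSum : ∀ m : ℕ, ∑ k ∈ range m, ((n : ℝ) - (k + 1) + 1) * (1 + z (k + 1) - z k) =
      m * n - (m : ℝ) * (m - 1) / 2 + (n - m + 1) * z m + ∑ k ∈ range m, z k := by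
    intro m
    induction m with
    | zero => simp [h0]
    | succ m ih =>
      rw [sum_range_succ, sum_range_succ, ih]
      push_cast
      ring
  rw [partialSum, hzn]
  ring

/-- The indicator of the zero coordinates of `y`, extended by `0` to all of `ℕ`. -/
noncomputable def zeroIndicator {n : ℕ} (y : Fin n → ℝ) (k : ℕ) : ℝ :=
  if h : k < n then (if y ⟨k, h⟩ = 0 then 1 else 0) else 0

theorem zeroIndicator_val {n : ℕ} (y : Fin n → ℝ) (j : Fin n) :
    zeroIndicator y j = if y j = 0 then 1 else 0 := by
  simp [zeroIndicator]

theorem zeroIndicator_of_le {n : ℕ} (y : Fin n → ℝ) {k : ℕ} (h : n ≤ k) :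
    zeroIndicator y k = 0 := by
  simp [zeroIndicator, Nat.not_lt.mpr h]

theorem zeroIndicator_nonneg {n : ℕ} (y : Fin n → ℝ) (k : ℕ) : 0 ≤ zeroIndicator y k := by
  unfold zeroIndicator
  split_ifs <;> norm_num

theorem zeroIndicator_le_one {n : ℕ} (y : Fin n → ℝ) (k : ℕ) : zeroIndicator y k ≤ 1 := by
  unfold zeroIndicator
  split_ifs <;> norm_num

/-- Produce one unit per period, moving the unit of each closed period to its predecessor. -/
noncomputable def shiftedPlan {n : ℕ} (y : Fin n → ℝ) (j : Fin n) : ℝ :=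
  1 + zeroIndicator y (j + 1) - zeroIndicator y j

theorem zeroIndicator_zero {n : ℕ} {y : Fin n → ℝ}
    (hfirst : ∀ j : Fin n, (j : ℕ) + 1 = 1 → y j = 1) : zeroIndicator y 0 = 0 := by
  unfold zeroIndicator
  split_ifs with h hy
  · rw [hfirst ⟨0, h⟩ rfl] at hy
    norm_num at hy
  all_goals rfl

theorem obj_shiftedPlan {n : ℕ} {y : Fin n → ℝ}
    (hfirst : ∀ j : Fin n, (j : ℕ) + 1 = 1 → y j = 1) :
    Obj n (shiftedPlan y) y =
      (n : ℝ) * (n + 1) / 2 + ∑ j, ((if y j = 0 then 1 else 0) + y j) := by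
  have cost := sum_range_cost_shift n (zeroIndicator y) (zeroIndicator_zero hfirst)
    (zeroIndicator_of_le y le_rfl)
  rw [← Fin.sum_univ_eq_sum_range, ← Fin.sum_univ_eq_sum_range] at cost
  simp only [zeroIndicator_val y] at cost
  simp only [Obj, shiftedPlan, zeroIndicator_val y, cost, Finset.sum_add_distrib, add_assoc]

theorem lpFeasible_shiftedPlan {n : ℕ} (heven : Even n) {y : Fin n → ℝ}
    (hval : ∀ j, y j = 0 ∨ y j = 1 / 2 ∨ y j = 1)
    (hfirst : ∀ j : Fin n, (j : ℕ) + 1 = 1 → y j = 1)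
    (hy : ∀ j : Fin n, Even ((j : ℕ) + 1) → y j = 1) :
    LPFeasible n (shiftedPlan y) y := by
  have partialSum : ∀ m : ℕ, ∑ k ∈ range m, (1 + zeroIndicator y (k + 1) - zeroIndicator y k) =
      m + zeroIndicator y m := by
    intro m
    simp_rw [add_sub_assoc]
    rw [sum_add_distrib, sum_range_sub, zeroIndicator_zero hfirst]
    simp
  refine ⟨fun i _ => ?_, ?_, fun j => ?_, fun j => ?_⟩
  · have prefixSum : ∑ k ∈ Iic i, shiftedPlan y k = (i + 1 : ℕ) + zeroIndicator y (i + 1) := by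
      rw [← partialSum, Nat.range_succ_eq_Iic, ← Fin.map_valEmbedding_Iic, sum_map]
      rfl
    rw [prefixSum]
    push_cast
    linarith [zeroIndicator_nonneg y (i + 1)]
  · have total := partialSum n
    rw [← Fin.sum_univ_eq_sum_range (fun k => 1 + zeroIndicator y (k + 1) - zeroIndicator y k),
      zeroIndicator_of_le y le_rfl, add_zero] at total
    exact total
  · have succ_eq_zero : y j ≠ 1 → zeroIndicator y (j + 1) = 0 ∧ (j : ℕ) + 2 ≤ n := by
      intro hj
      have hodd : ¬ Even ((j : ℕ) + 1) := fun h => hj (hy j h)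
      have hlt : (j : ℕ) + 1 < n :=
        lt_of_le_of_ne j.2 fun h => hodd (by rwa [h])
      refine ⟨?_, hlt⟩
      have hnext : y ⟨j + 1, hlt⟩ = 1 := hy _ (Nat.even_add_one.mpr hodd)
      simp [zeroIndicator, hlt, hnext]
    have hval_j := zeroIndicator_val y j
    unfold shiftedPlan
    rcases hval j with h | h | h
    · rw [hval_j, (succ_eq_zero (by rw [h]; norm_num)).1, h]
      norm_num
    · obtain ⟨hz, hjn⟩ := succ_eq_zero (by rw [h]; norm_num)
      have hjn' : (j : ℝ) + 2 ≤ n := by exact_mod_cast hjn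
      rw [hval_j, hz, h]
      norm_num
      linarith
    · rw [hval_j, h]
      have hnonneg := zeroIndicator_nonneg y (j + 1)
      have hle := zeroIndicator_le_one y (j + 1)
      rcases Nat.lt_or_ge ((j : ℕ) + 1) n with hlt | hge
      · have hlt' : (j : ℝ) + 2 ≤ n := by exact_mod_cast hlt
        norm_num
        constructor <;> linarith
      · have hjn : (j : ℝ) + 1 ≤ n := by exact_mod_cast j.2
        rw [zeroIndicator_of_le y hge]
        norm_num
        linarith
  · rcases hval j with h | h | h <;> rw [h] <;> norm_num

/-- for even `n ≥ 2`, a convex set `C` over which the LP value is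
at least the integer optimum contains at most one element of `S`. -/
theorem convex_pruned_at_most_one_Seven (n : ℕ) (hn : 2 ≤ n) (heven : Even n)
    (C : Set (Fin n → ℝ)) (hC : Convex ℝ C)
    (hbound : ∀ x y : Fin n → ℝ, LPFeasible n x y → y ∈ C →
      Obj n x y ≥ (n : ℝ) * (n + 1) / 2 + n) :
    (C ∩ Seven n).Subsingleton := by
  intro a ⟨haC, ha, ha_first, ha_even⟩ b ⟨hbC, hb, hb_first, hb_even⟩
  set y : Fin n → ℝ := (1 / 2 : ℝ) • a + (1 / 2 : ℝ) • b with hy_def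
  have hyC : y ∈ C := hC haC hbC (by norm_num) (by norm_num) (by norm_num)
  have hy_apply : ∀ j, y j = (a j + b j) / 2 := fun j => by
    simp only [hy_def, Pi.add_apply, Pi.smul_apply, smul_eq_mul]
    ring
  have hval : ∀ j, y j = 0 ∨ y j = 1 / 2 ∨ y j = 1 := fun j => by
    rcases ha j with h | h <;> rcases hb j with h' | h' <;> rw [hy_apply, h, h'] <;> norm_num
  have hfirst : ∀ j : Fin n, (j : ℕ) + 1 = 1 → y j = 1 := fun j hj => by
    rw [hy_apply, ha_first j hj, hb_first j hj]
    norm_num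
  have hy_even : ∀ j : Fin n, Even ((j : ℕ) + 1) → y j = 1 := fun j hj => by
    rw [hy_apply, ha_even j hj, hb_even j hj]
    norm_num
  have hobj := hbound _ _ (lpFeasible_shiftedPlan heven hval hfirst hy_even) hyC
  rw [obj_shiftedPlan hfirst] at hobj
  by_contra hab
  obtain ⟨i, hi⟩ := Function.ne_iff.mp hab
  have hi_half : y i = 1 / 2 := by
    rcases ha i with h | h <;> rcases hb i with h' | h' <;> rw [hy_apply] <;> simp_all
  have hlt : ∑ j, ((if y j = 0 then (1 : ℝ) else 0) + y j) < ∑ _j : Fin n, (1 : ℝ) := by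
    refine sum_lt_sum (fun j _ => ?_) ⟨i, mem_univ i, ?_⟩
    · rcases hval j with h | h | h <;> rw [h] <;> norm_num
    · rw [hi_half]
      norm_num
  simp only [sum_const, card_univ, Fintype.card_fin, nsmul_eq_mul, mul_one] at hlt
  linarith
end

section
/- Let n ≥ 2 be even and let (C_i)_{i ∈ I} be a finite family of convex subsets of ℝ^n such that (a) every y ∈ S lies in C_i for some i ∈ I, and (b) for every i ∈ I, every LP-feasible pair (x, y) for the lot-sizing instance with y ∈ C_i satisfies Obj(x, y) ≥ n(n+1)/2 + n. Then |I| ≥ 2^{n/2 - 1}. -/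
open Finset

theorem sum_Iic_val {n : ℕ} (f : ℕ → ℝ) (i : Fin n) :
    ∑ k ∈ Finset.Iic i, f k = ∑ k ∈ Finset.range ((i : ℕ) + 1), f k := by
  rw [Nat.range_succ_eq_Iic, ← Fin.map_valEmbedding_Iic, Finset.sum_map]
  rfl

theorem sum_one_sub_add_succ (e : ℕ → ℝ) (h0 : e 0 = 0) (m : ℕ) :
    ∑ k ∈ Finset.range m, (1 - e k + e (k + 1)) = m + e m := by
  induction m with
  | zero => simp [h0]
  | succ m ih => rw [Finset.sum_range_succ, ih]; push_cast; ring

theorem sum_weighted_one_sub_add_succ (e : ℕ → ℝ) (h0 : e 0 = 0) (c : ℝ) (m : ℕ) :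
    ∑ k ∈ Finset.range m, (c - (k + 1) + 1) * (1 - e k + e (k + 1)) =
      c * m - m * (m - 1) / 2 + ∑ k ∈ Finset.range m, e k + (c - m + 1) * e m := by
  induction m with
  | zero => simp [h0]
  | succ m ih =>
    rw [Finset.sum_range_succ, ih, Finset.sum_range_succ]; push_cast; ring

/-- The indicator of the periods with no setup, extended by `0` beyond the horizon. -/
noncomputable def idle {n : ℕ} (z : Fin n → ℝ) (k : ℕ) : ℝ :=
  if h : k < n then if z ⟨k, h⟩ = 0 then 1 else 0 else 0

theorem idle_val {n : ℕ} (z : Fin n → ℝ) (j : Fin n) :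
    idle z j = if z j = 0 then 1 else 0 := by
  simp [idle]

theorem idle_nonneg {n : ℕ} (z : Fin n → ℝ) (k : ℕ) : 0 ≤ idle z k := by
  unfold idle; split_ifs <;> norm_num

theorem idle_le_one {n : ℕ} (z : Fin n → ℝ) (k : ℕ) : idle z k ≤ 1 := by
  unfold idle; split_ifs <;> norm_num

theorem idle_of_le {n : ℕ} (z : Fin n → ℝ) {k : ℕ} (h : n ≤ k) : idle z k = 0 := by
  simp [idle, not_lt.mpr h]

/-- A half-integral setup vector with an entry `1 / 2` has LP value below the integer optimum:
produce one unit in every period, moving the unit of an idle period to its predecessor. -/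
theorem exists_lpFeasible_obj_lt {n : ℕ} (heven : Even n) (z : Fin n → ℝ)
    (hz : ∀ j, z j = 0 ∨ z j = 1 / 2 ∨ z j = 1)
    (hfirst : ∀ j : Fin n, (j : ℕ) + 1 = 1 → z j = 1)
    (heven_one : ∀ j : Fin n, Even ((j : ℕ) + 1) → z j = 1)
    (hhalf : ∃ j, z j = 1 / 2) :
    ∃ x, LPFeasible n x z ∧ Obj n x z < (n : ℝ) * (n + 1) / 2 + n := by
  have h0 : idle z 0 = 0 := by
    by_cases h : 0 < n
    · simp [idle, h, hfirst ⟨0, h⟩ rfl]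
    · simp [idle, h]
  have hn0 : idle z n = 0 := idle_of_le z le_rfl
  have hsucc (j : Fin n) (hj : z j ≠ 1) : idle z (j + 1) = 0 ∧ (j : ℝ) + 2 ≤ n := by
    have hodd : ¬ Even ((j : ℕ) + 1) := fun h => hj (heven_one j h)
    have hlt : (j : ℕ) + 1 < n := by
      rcases Nat.lt_or_ge ((j : ℕ) + 1) n with h | h
      · exact h
      · exact absurd (by rwa [show (j : ℕ) + 1 = n by omega]) hodd
    refine ⟨?_, by exact_mod_cast hlt⟩
    have : z ⟨j + 1, hlt⟩ = 1 := heven_one _ (by simpa using Nat.even_add_one.mpr hodd)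
    simp [idle, hlt, this]
  refine ⟨fun j => 1 - idle z j + idle z (j + 1), ⟨fun i _ => ?_, ?_, fun j => ⟨?_, ?_⟩,
    fun j => ?_⟩, ?_⟩
  · rw [sum_Iic_val (fun k => 1 - idle z k + idle z (k + 1)), sum_one_sub_add_succ _ h0]
    push_cast
    linarith [idle_nonneg z (i + 1)]
  · rw [Fin.sum_univ_eq_sum_range (fun k => 1 - idle z k + idle z (k + 1)),
      sum_one_sub_add_succ _ h0, hn0, add_zero]
  · linarith [idle_le_one z j, idle_nonneg z (j + 1)]
  · rcases hz j with h | h | h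
    · simp [idle_val, h, (hsucc j (by norm_num [h])).1]
    · have := hsucc j (by norm_num [h])
      simp only [idle_val, h, this.1]
      norm_num
      linarith
    · have hle : (j : ℝ) + 1 ≤ n := by exact_mod_cast j.isLt
      simp only [idle_val, h]
      rcases Nat.lt_or_ge ((j : ℕ) + 1) n with hj | hj
      · have : (j : ℝ) + 2 ≤ n := by exact_mod_cast hj
        norm_num
        linarith [idle_le_one z (j + 1)]
      · rw [idle_of_le z hj]
        norm_num
        linarith
  · rcases hz j with h | h | h <;> norm_num [h]
  · have hlt : ∑ j : Fin n, (idle z j + z j) < ∑ _j : Fin n, (1 : ℝ) := by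
      refine Finset.sum_lt_sum (fun j _ => ?_) ?_
      · rw [idle_val]
        rcases hz j with h | h | h <;> norm_num [h]
      · obtain ⟨j, hj⟩ := hhalf
        exact ⟨j, Finset.mem_univ j, by norm_num [idle_val, hj]⟩
    rw [Finset.sum_add_distrib, Fin.sum_univ_eq_sum_range (idle z)] at hlt
    simp only [Finset.sum_const, Finset.card_univ, Fintype.card_fin, nsmul_eq_mul, mul_one] at hlt
    unfold Obj
    rw [Fin.sum_univ_eq_sum_range
      (fun k => ((n : ℝ) - ((k : ℕ) + 1) + 1) * (1 - idle z k + idle z (k + 1))),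
      sum_weighted_one_sub_add_succ _ h0, hn0]
    linarith

theorem eq_of_mem_seven_of_mem_convex {n : ℕ} (heven : Even n) {C : Set (Fin n → ℝ)}
    (hconv : Convex ℝ C)
    (hbound : ∀ x y : Fin n → ℝ, LPFeasible n x y → y ∈ C →
      Obj n x y ≥ (n : ℝ) * (n + 1) / 2 + n)
    {u v : Fin n → ℝ} (hu : u ∈ Seven n) (hv : v ∈ Seven n) (huC : u ∈ C) (hvC : v ∈ C) :
    u = v := by
  by_contra hne
  obtain ⟨j, hj⟩ := Function.ne_iff.mp hne
  have hmem : (1 / 2 : ℝ) • u + (1 / 2 : ℝ) • v ∈ C :=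
    hconv huC hvC (by norm_num) (by norm_num) (by norm_num)
  obtain ⟨x, hx, hlt⟩ := exists_lpFeasible_obj_lt heven ((1 / 2 : ℝ) • u + (1 / 2 : ℝ) • v)
    (fun j => by
      rcases hu.1 j with h | h <;> rcases hv.1 j with h' | h' <;> norm_num [h, h'])
    (fun j hj => by norm_num [hu.2.1 j hj, hv.2.1 j hj])
    (fun j hj => by norm_num [hu.2.2 j hj, hv.2.2 j hj])
    ⟨j, by
      rcases hu.1 j with h | h <;> rcases hv.1 j with h' | h' <;> simp_all⟩
  exact absurd hlt (not_lt.mpr (hbound x _ hx hmem))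

/-- The member of `Seven n` whose entries at the periods `3, 5, …, n - 1` are prescribed. -/
noncomputable def sevenOf (n : ℕ) (b : Fin (n / 2 - 1) → Bool) (j : Fin n) : ℝ :=
  if h : (j : ℕ) / 2 - 1 < n / 2 - 1 ∧ 2 ≤ (j : ℕ) ∧ ¬ Even ((j : ℕ) + 1) then
    if b ⟨(j : ℕ) / 2 - 1, h.1⟩ then 1 else 0
  else 1

theorem sevenOf_mem (n : ℕ) (b : Fin (n / 2 - 1) → Bool) : sevenOf n b ∈ Seven n := by
  refine ⟨fun j => ?_, fun j hj => ?_, fun j hj => ?_⟩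
  · unfold sevenOf; split_ifs <;> simp
  · exact dif_neg fun h => by omega
  · exact dif_neg fun h => h.2.2 hj

theorem sevenOf_injective (n : ℕ) : Function.Injective (sevenOf n) := by
  intro a b hab
  funext k
  have hk := k.isLt
  have hcond : (2 * ((k : ℕ) + 1)) / 2 - 1 < n / 2 - 1 ∧ 2 ≤ 2 * ((k : ℕ) + 1) ∧
      ¬ Even (2 * ((k : ℕ) + 1) + 1) := by
    refine ⟨by omega, by omega, ?_⟩
    rw [Nat.not_even_iff_odd]
    exact odd_two_mul_add_one _
  have hval (c : Fin (n / 2 - 1) → Bool) :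
      sevenOf n c ⟨2 * ((k : ℕ) + 1), by omega⟩ = if c k then 1 else 0 := by
    have hidx : (⟨(2 * ((k : ℕ) + 1)) / 2 - 1, hcond.1⟩ : Fin (n / 2 - 1)) = k :=
      Fin.ext (by simp)
    unfold sevenOf
    rw [dif_pos hcond, hidx]
  have h := congrFun hab ⟨2 * ((k : ℕ) + 1), by omega⟩
  rw [hval, hval] at h
  cases ha : a k <;> cases hb : b k <;> simp_all

/-- for even `n ≥ 2`, any finite family of convex sets covering `S`
on which the LP value is at least the integer optimum has at least
`2^{n/2 - 1}` members. -/
theorem leaf_lower_bound_even (n : ℕ) (hn : 2 ≤ n) (heven : Even n)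
    {ι : Type*} [Fintype ι] (C : ι → Set (Fin n → ℝ))
    (hconv : ∀ i, Convex ℝ (C i))
    (hcover : ∀ y ∈ Seven n, ∃ i, y ∈ C i)
    (hbound : ∀ i, ∀ x y : Fin n → ℝ, LPFeasible n x y → y ∈ C i →
      Obj n x y ≥ (n : ℝ) * (n + 1) / 2 + n) :
    2 ^ (n / 2 - 1) ≤ Fintype.card ι := by
  choose f hf using fun b => hcover (sevenOf n b) (sevenOf_mem n b)
  have hinj : Function.Injective f := fun a b hab =>
    sevenOf_injective n <| eq_of_mem_seven_of_mem_convex heven (hconv (f a)) (hbound (f a))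
      (sevenOf_mem n a) (sevenOf_mem n b) (hf a) (hab ▸ hf b)
  simpa using Fintype.card_le_of_injective f hinj
end
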